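/- arXiv:2512.21764 — 4 statements merged into one kernel-verified Lean document; each statement's English description precedes it below -/
import Mathlib

section
/- For every pair (y, τ) with y a uniformly random m-bit string and τ a uniformly random seed, the probability that inversion succeeds on (y, τ) is at most 2^(n−m) times the inverter's average success probability on images. Precisely: (|{(y, τ) : (Fin m → Bool) × T | C (M y τ) = y}| : ℝ) / (2^m * |T|) ≤ ((2:ℝ)^n / 2^m) * p. -/
/-- Sending `(y, t)` to `(M y t, t)` embeds the successful pairs with arbitrary target `y` into the
successful pairs whose target is an image `C x`. -/
theorem card_invert_le_card_invert_image {α β T : Type*} [Fintype α] [Fintype β] [DecidableEq β]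
    [Fintype T] (C : α → β) (M : β → T → α) :
    (Finset.univ.filter (fun p : β × T => C (M p.1 p.2) = p.1)).card ≤
      (Finset.univ.filter (fun p : α × T => C (M (C p.1) p.2) = C p.1)).card := by
  refine Finset.card_le_card_of_injOn (fun p => (M p.1 p.2, p.2)) ?_ ?_
  · rintro ⟨y, t⟩ h
    simp_all
  · rintro ⟨y, t⟩ h ⟨y', t'⟩ h' heq
    simp only [Finset.coe_filter, Finset.mem_univ, true_and, Set.mem_ofPred_eq] at h h'
    simp only [Prod.mk.injEq] at heq ⊢
    exact ⟨by rw [← h, ← h', heq.1], heq.2⟩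

/-- The probability that the inverter succeeds on a uniformly random
pair `(y, τ)` (with `y` a uniformly random `m`-bit string) is at most
`2^(n-m)` times its average success probability `p` on images `C x`. -/
theorem avoid_invert_prob_le
    (n m : ℕ) (C : (Fin n → Bool) → (Fin m → Bool))
    (T : Type) [Fintype T] [Nonempty T]
    (M : (Fin m → Bool) → T → (Fin n → Bool)) :
    ((Finset.univ.filter
        (fun yτ : (Fin m → Bool) × T => C (M yτ.1 yτ.2) = yτ.1)).card : ℝ)
      / (2 ^ m * Fintype.card T)
    ≤ ((2 : ℝ) ^ n / 2 ^ m) *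
      (((Finset.univ.filter
          (fun xτ : (Fin n → Bool) × T => C (M (C xτ.1) xτ.2) = C xτ.1)).card : ℝ)
        / (2 ^ n * Fintype.card T)) := by
  have cancel : ∀ a b c d : ℝ, a ≠ 0 → a / b * (c / (a * d)) = c / (b * d) := by
    intro a b c d ha
    rw [div_mul_div_comm, mul_left_comm b a d, mul_div_mul_left _ _ ha]
  rw [cancel _ _ _ _ (by positivity)]
  gcongr ?_ / _
  exact_mod_cast card_invert_le_card_invert_image C M
end

section
/- Assume m > n. Then the set of pairs (y, τ) on which inversion fails is nonempty, and conditioned on inversion failing on a uniformly random pair (y, τ), the string y lies outside the range of C with probability at least p. Precisely: the Finset F := {(y, τ) : (Fin m → Bool) × T | C (M y τ) ≠ y} is nonempty, and (|{(y, τ) ∈ F | y ∉ Set.range C}| : ℝ) / |F| ≥ p. -/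
open Classical

/-- A failure set of size `a + b`, of which `a ≥ k` failures are outside the range and `b ≤ f` are
inside, where `s` and `f` count the successes and failures among `k` trials. -/
theorem div_le_div_add_of_le {s f k a b : ℝ} (hk : 0 < k) (hf : 0 ≤ f) (hb : 0 ≤ b)
    (hs : s + f = k) (hs0 : 0 ≤ s) (ha : k ≤ a) (hbf : b ≤ f) : s / k ≤ a / (a + b) := by
  rw [div_le_div_iff₀ hk (by linarith)]
  subst hs
  nlinarith [mul_le_mul_of_nonneg_left hbf hs0, mul_le_mul_of_nonneg_right ha hf,
    mul_nonneg hf hf]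

/-- Pairs whose first coordinate avoids the range of `C` are at least as numerous as the pairs of
an input and a seed, when the outputs of `C` are longer than its inputs. -/
theorem card_mul_le_card_compl_image_product {n m : ℕ} (h : n < m)
    (C : (Fin n → Bool) → (Fin m → Bool)) (T : Type*) [Fintype T] :
    2 ^ n * Fintype.card T ≤
      ((Finset.univ.image C)ᶜ ×ˢ (Finset.univ : Finset T)).card := by
  rw [Finset.card_product, Finset.card_compl, Finset.card_univ]
  refine Nat.mul_le_mul_right _ ?_
  have himage : (Finset.univ.image C).card ≤ 2 ^ n := by
    simpa using Finset.card_image_le (s := Finset.univ) (f := C)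
  have hpow : 2 ^ (n + 1) ≤ 2 ^ m := Nat.pow_le_pow_right two_pos h
  simp only [Fintype.card_fun, Fintype.card_bool, Fintype.card_fin]
  omega

/-- If `m > n`, the set of pairs `(y, τ)` on which inversion fails is
nonempty, and conditioned on failure, `y` lies outside the range of `C` with
probability at least the average inversion success probability `p` on images. -/
theorem avoid_cond_outside_range
    (n m : ℕ) (h : m > n) (C : (Fin n → Bool) → (Fin m → Bool))
    (T : Type) [Fintype T] [Nonempty T]
    (M : (Fin m → Bool) → T → (Fin n → Bool)) :
    (Finset.univ.filter
        (fun yτ : (Fin m → Bool) × T => C (M yτ.1 yτ.2) ≠ yτ.1)).Nonempty ∧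
    (((Finset.univ.filter
          (fun yτ : (Fin m → Bool) × T => C (M yτ.1 yτ.2) ≠ yτ.1)).filter
        (fun yτ : (Fin m → Bool) × T => yτ.1 ∉ Set.range C)).card : ℝ)
      / ((Finset.univ.filter
          (fun yτ : (Fin m → Bool) × T => C (M yτ.1 yτ.2) ≠ yτ.1)).card : ℝ)
    ≥ ((Finset.univ.filter
          (fun xτ : (Fin n → Bool) × T => C (M (C xτ.1) xτ.2) = C xτ.1)).card : ℝ)
        / (2 ^ n * Fintype.card T) := by
  set F := Finset.univ.filter
    (fun yτ : (Fin m → Bool) × T => C (M yτ.1 yτ.2) ≠ yτ.1)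
  set A := F.filter (fun yτ : (Fin m → Bool) × T => yτ.1 ∉ Set.range C)
  set B := F.filter (fun yτ : (Fin m → Bool) × T => ¬ yτ.1 ∉ Set.range C)
  set S := Finset.univ.filter
    (fun xτ : (Fin n → Bool) × T => C (M (C xτ.1) xτ.2) = C xτ.1)
  set S' := Finset.univ.filter
    (fun xτ : (Fin n → Bool) × T => ¬ C (M (C xτ.1) xτ.2) = C xτ.1)
  have hF : A.card + B.card = F.card := Finset.card_filter_add_card_filter_not _
  have hS : S.card + S'.card = 2 ^ n * Fintype.card T := by
    have := Finset.card_filter_add_card_filter_not (s := Finset.univ)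
      (fun xτ : (Fin n → Bool) × T => C (M (C xτ.1) xτ.2) = C xτ.1)
    simpa [S, S'] using this
  have hA : 2 ^ n * Fintype.card T ≤ A.card := by
    refine (card_mul_le_card_compl_image_product h C T).trans (Finset.card_le_card ?_)
    rintro ⟨y, τ⟩ hy
    have hy' : ∀ x, C x ≠ y := by simpa using hy
    simpa [A, F] using ⟨hy' _, hy'⟩
  have hB : B.card ≤ S'.card := by
    refine (Finset.card_le_card ?_).trans
      (Finset.card_image_le (s := S') (f := fun xτ => (C xτ.1, xτ.2)))
    rintro ⟨y, τ⟩ hy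
    obtain ⟨hfail, x, rfl⟩ : C (M y τ) ≠ y ∧ ∃ x, C x = y := by simpa [B, F] using hy
    exact Finset.mem_image.2 ⟨(x, τ), by simpa [S'] using hfail, rfl⟩
  have hpos : 0 < 2 ^ n * Fintype.card T := Nat.mul_pos (by positivity) Fintype.card_pos
  refine ⟨Finset.card_pos.1 (by omega), ?_⟩
  rw [ge_iff_le, ← hF, Nat.cast_add]
  exact div_le_div_add_of_le (f := S'.card) (by exact_mod_cast hpos) (by positivity)
    (by positivity) (by exact_mod_cast hS) (by positivity) (by exact_mod_cast hA)
    (by exact_mod_cast hB)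
end

section
/- Assume m > n. Then the probability, over a uniformly random pair (y, τ), that y lies in the range of C and yet inversion fails on (y, τ) is at most 1 − p. Precisely: (|{(y, τ) : (Fin m → Bool) × T | y ∈ Set.range C ∧ C (M y τ) ≠ y}| : ℝ) / (2^m * |T|) ≤ 1 − p. -/
open Classical

/-- If `m > n`, the probability over a uniformly random pair `(y, τ)`
that `y` lies in the range of `C` and yet inversion fails on `(y, τ)` is at most
`1 - p`, where `p` is the average inversion success probability on images. -/
theorem avoid_round_error_le
    (n m : ℕ) (h : m > n) (C : (Fin n → Bool) → (Fin m → Bool))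
    (T : Type) [Fintype T] [Nonempty T]
    (M : (Fin m → Bool) → T → (Fin n → Bool)) :
    ((Finset.univ.filter
        (fun yτ : (Fin m → Bool) × T =>
          yτ.1 ∈ Set.range C ∧ C (M yτ.1 yτ.2) ≠ yτ.1)).card : ℝ)
      / (2 ^ m * Fintype.card T)
    ≤ 1 - ((Finset.univ.filter
          (fun xτ : (Fin n → Bool) × T => C (M (C xτ.1) xτ.2) = C xτ.1)).card : ℝ)
        / (2 ^ n * Fintype.card T) := by
  set F := Finset.univ.filter
    (fun xτ : (Fin n → Bool) × T => ¬ C (M (C xτ.1) xτ.2) = C xτ.1) with hF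
  have hcard : (((Finset.univ.filter
      (fun xτ : (Fin n → Bool) × T => C (M (C xτ.1) xτ.2) = C xτ.1)).card : ℝ))
      + F.card = 2 ^ n * Fintype.card T := by
    have := Finset.card_filter_add_card_filter_not (s := Finset.univ)
      (fun xτ : (Fin n → Bool) × T => C (M (C xτ.1) xτ.2) = C xτ.1)
    rw [Finset.card_univ, Fintype.card_prod, Fintype.card_fun, Fintype.card_bool,
      Fintype.card_fin] at this
    exact_mod_cast this
  have hle : (Finset.univ.filter (fun yτ : (Fin m → Bool) × T =>
      yτ.1 ∈ Set.range C ∧ C (M yτ.1 yτ.2) ≠ yτ.1)).card ≤ F.card := by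
    refine Finset.card_le_card_of_surjOn (fun xτ => (C xτ.1, xτ.2)) ?_
    rintro ⟨y, τ⟩ hy
    obtain ⟨⟨x, rfl⟩, hx⟩ := (Finset.mem_filter.mp (Finset.mem_coe.mp hy)).2
    exact ⟨(x, τ), by simpa [hF] using hx, rfl⟩
  have hT : (0 : ℝ) < Fintype.card T := by exact_mod_cast Fintype.card_pos
  have hpos : (0 : ℝ) < 2 ^ n * Fintype.card T := by positivity
  rw [one_sub_div hpos.ne', ← hcard, add_sub_cancel_left, hcard]
  gcongr
  norm_num
end

section
/- Assume m > n and let t be a natural number. Sample ω : Fin t → ((Fin m → Bool) × T) uniformly at random, writing ω i = (y_i, τ_i), and consider the procedure that outputs y_i for the smallest index i such that C (M y_i τ_i) ≠ y_i, and outputs ⊥ if inversion succeeds on (y_i, τ_i) for every i. Then the probability that the procedure errs — i.e., either outputs ⊥, or outputs a string lying in the range of C — is at most t · (1 − p) + (2^n / 2^m)^t. Precisely: (|{ω : Fin t → ((Fin m → Bool) × T) | (∀ i, C (M (ω i).1 (ω i).2) = (ω i).1) ∨ (∃ i, (∀ j, j < i → C (M (ω j).1 (ω j).2) = (ω j).1)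 ∧ C (M (ω i).1 (ω i).2) ≠ (ω i).1 ∧ (ω i).1 ∈ Set.range C)}| : ℝ) / (2^m * |T|)^t ≤ t * (1 − p) + ((2:ℝ)^n / 2^m)^t. -/
open Classical

/-- Under the uniform distribution on functions `ι → α`, each coordinate is uniform on `α`. -/
theorem card_filter_apply_mem_mul_card {ι α : Type*} [Fintype ι] [DecidableEq ι] [Fintype α] (i : ι)
    (F : Finset α) :
    (Finset.univ.filter (fun ω : ι → α => ω i ∈ F)).card * Fintype.card α
      = F.card * Fintype.card α ^ Fintype.card ι := by
  have hpi : Finset.univ.filter (fun ω : ι → α => ω i ∈ F)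
      = Fintype.piFinset (Function.update (fun _ => Finset.univ) i F) := by
    ext ω
    simp only [Finset.mem_filter, Finset.mem_univ, true_and, Fintype.mem_piFinset]
    constructor
    · intro hω j
      by_cases hj : j = i
      · subst hj
        simpa using hω
      · simp [hj]
    · intro hω
      simpa using hω i
  have hcard : ∀ j, (Function.update (fun _ => (Finset.univ : Finset α)) i F j).card
      = Function.update (fun _ => Fintype.card α) i F.card j := by
    intro j
    by_cases hj : j = i
    · subst hj
      simp
    · simp [hj]
  have hpos : 0 < Fintype.card ι := Fintype.card_pos_iff.2 ⟨i⟩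
  rw [hpi, Fintype.card_piFinset, Finset.prod_congr rfl fun j _ => hcard j,
    Finset.prod_update_of_mem (Finset.mem_univ i), Finset.prod_const,
    Finset.card_sdiff_of_subset (Finset.subset_univ _), Finset.card_singleton, Finset.card_univ,
    mul_assoc, ← pow_succ, Nat.sub_add_cancel hpos]

/-- Union bound: a tuple of `t` independent uniform samples lies entirely in `S` or meets `F`
with probability at most `t * |F| / |α| + (|S| / |α|) ^ t`. -/
theorem card_div_le_of_forall_mem_or_exists_mem {α : Type*} [Fintype α] [Nonempty α] {t : ℕ}
    (S F : Finset α) (E : Finset (Fin t → α))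
    (hE : ∀ ω ∈ E, (∀ i, ω i ∈ S) ∨ ∃ i, ω i ∈ F) :
    (E.card : ℝ) / (Fintype.card α : ℝ) ^ t
      ≤ t * ((F.card : ℝ) / Fintype.card α) + ((S.card : ℝ) / Fintype.card α) ^ t := by
  have hN : (0 : ℝ) < Fintype.card α := by exact_mod_cast Fintype.card_pos
  have hsub : E ⊆ Finset.univ.biUnion
      (fun i => Finset.univ.filter (fun ω : Fin t → α => ω i ∈ F)) ∪
        Fintype.piFinset (fun _ => S) := by
    intro ω hω
    rcases hE ω hω with hS | ⟨i, hi⟩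
    · exact Finset.mem_union_right _ (Fintype.mem_piFinset.2 hS)
    · exact Finset.mem_union_left _ (Finset.mem_biUnion.2 ⟨i, Finset.mem_univ i, by simpa using hi⟩)
  have hcard : E.card ≤
      ∑ i, (Finset.univ.filter (fun ω : Fin t → α => ω i ∈ F)).card + S.card ^ t := by
    refine (Finset.card_le_card hsub).trans ((Finset.card_union_le _ _).trans ?_)
    refine Nat.add_le_add Finset.card_biUnion_le ?_
    simp
  have hcoord : ∀ i : Fin t, ((Finset.univ.filter (fun ω : Fin t → α => ω i ∈ F)).card : ℝ)
      = F.card / Fintype.card α * (Fintype.card α : ℝ) ^ t := by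
    intro i
    have hmul := card_filter_apply_mem_mul_card i F
    rw [Fintype.card_fin] at hmul
    rw [div_mul_eq_mul_div, eq_div_iff hN.ne']
    exact_mod_cast hmul
  have hreal : (E.card : ℝ) ≤
      ∑ i, ((Finset.univ.filter (fun ω : Fin t → α => ω i ∈ F)).card : ℝ)
        + (S.card : ℝ) ^ t := by
    exact_mod_cast hcard
  rw [Finset.sum_congr rfl fun i _ => hcoord i, Finset.sum_const, Finset.card_univ,
    Fintype.card_fin, nsmul_eq_mul] at hreal
  rw [div_le_iff₀ (by positivity), add_mul, div_pow, div_mul_cancel₀ _ (by positivity)]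
  linarith

/-- The repeated-sampling procedure for Range Avoidance: sampling
`t` independent pairs `(y_i, τ_i)` uniformly at random and outputting the first
`y_i` on which inversion fails (or `⊥` if inversion succeeds on all pairs), the
probability that the procedure errs — either outputs `⊥` or outputs a string in
the range of `C` — is at most `t * (1 - p) + (2^n / 2^m)^t`. -/
theorem avoid_procedure_error_le
    (n m : ℕ) (h : m > n) (C : (Fin n → Bool) → (Fin m → Bool))
    (T : Type) [Fintype T] [Nonempty T]
    (M : (Fin m → Bool) → T → (Fin n → Bool)) (t : ℕ) :
    ((Finset.univ.filter
        (fun ω : Fin t → ((Fin m → Bool) × T) =>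
          (∀ i, C (M (ω i).1 (ω i).2) = (ω i).1) ∨
          (∃ i, (∀ j, j < i → C (M (ω j).1 (ω j).2) = (ω j).1) ∧
            C (M (ω i).1 (ω i).2) ≠ (ω i).1 ∧ (ω i).1 ∈ Set.range C))).card : ℝ)
      / ((2 : ℝ) ^ m * Fintype.card T) ^ t
    ≤ t * (1 - ((Finset.univ.filter
          (fun xτ : (Fin n → Bool) × T => C (M (C xτ.1) xτ.2) = C xτ.1)).card : ℝ)
        / (2 ^ n * Fintype.card T))
      + ((2 : ℝ) ^ n / 2 ^ m) ^ t := by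
  let α := (Fin m → Bool) × T
  let S : Finset α := Finset.univ.filter (fun z => C (M z.1 z.2) = z.1)
  let F : Finset α :=
    Finset.univ.filter (fun z => C (M z.1 z.2) ≠ z.1 ∧ z.1 ∈ Set.range C)
  let good : Finset ((Fin n → Bool) × T) :=
    Finset.univ.filter (fun z => C (M (C z.1) z.2) = C z.1)
  let g : (Fin n → Bool) × T → α := fun z => (C z.1, z.2)
  have hT : (0 : ℝ) < Fintype.card T := by exact_mod_cast Fintype.card_pos
  have hα : (Fintype.card α : ℝ) = 2 ^ m * Fintype.card T := by
    simp [α]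
  have hdom : (Fintype.card ((Fin n → Bool) × T) : ℝ) = 2 ^ n * Fintype.card T := by
    simp
  have hS : (S.card : ℝ) ≤ 2 ^ n * Fintype.card T := by
    rw [← hdom, ← Finset.card_univ]
    refine Nat.cast_le.2 (Finset.card_le_card_of_surjOn g ?_)
    intro z hz
    have hz' : C (M z.1 z.2) = z.1 := by simpa [S] using hz
    exact ⟨(M z.1 z.2, z.2), by simp, Prod.ext hz' rfl⟩
  have hF : (F.card : ℝ) ≤ 2 ^ n * Fintype.card T - good.card := by
    have hle : F.card ≤ goodᶜ.card := by
      refine Finset.card_le_card_of_surjOn g ?_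
      rintro ⟨y, τ⟩ hz
      obtain ⟨hne, x, rfl⟩ : C (M y τ) ≠ y ∧ y ∈ Set.range C := by
        simpa only [F, Finset.coe_filter, Finset.mem_univ, true_and, Set.mem_ofPred_eq] using hz
      exact ⟨(x, τ), by simpa [good] using hne, rfl⟩
    have hadd := Finset.card_add_card_compl good
    have hadd' : (good.card : ℝ) + goodᶜ.card = 2 ^ n * Fintype.card T := by
      rw [← hdom]
      exact_mod_cast hadd
    have hle' : (F.card : ℝ) ≤ goodᶜ.card := by exact_mod_cast hle
    linarith
  have hpow : (2 : ℝ) ^ n ≤ 2 ^ m := pow_le_pow_right₀ one_le_two h.le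
  have hFdiv : (F.card : ℝ) / (2 ^ m * Fintype.card T)
      ≤ 1 - (good.card : ℝ) / (2 ^ n * Fintype.card T) := by
    calc (F.card : ℝ) / (2 ^ m * Fintype.card T)
        ≤ F.card / (2 ^ n * Fintype.card T) := by gcongr
      _ ≤ (2 ^ n * Fintype.card T - good.card) / (2 ^ n * Fintype.card T) := by gcongr
      _ = 1 - (good.card : ℝ) / (2 ^ n * Fintype.card T) := by
        rw [sub_div, div_self (by positivity)]
  have hSdiv : (S.card : ℝ) / (2 ^ m * Fintype.card T) ≤ 2 ^ n / 2 ^ m := by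
    rw [← mul_div_mul_right ((2 : ℝ) ^ n) (2 ^ m) hT.ne']
    gcongr
  rw [← hα]
  refine (card_div_le_of_forall_mem_or_exists_mem S F _ ?_).trans ?_
  · intro ω hω
    rcases (Finset.mem_filter.1 hω).2 with hall | ⟨i, -, hi⟩
    · exact Or.inl fun i => Finset.mem_filter.2 ⟨Finset.mem_univ _, hall i⟩
    · exact Or.inr ⟨i, Finset.mem_filter.2 ⟨Finset.mem_univ _, hi⟩⟩
  · rw [hα]
    gcongr
end
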